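/- Let (G,q) be a nondegenerate metric group with |G| = 4 such that ∑_{g∈G} q(g) = 2. Then G contains a Lagrangian subgroup of order 2, i.e., a subgroup H of order 2 with q(h) = 1 for all h ∈ H and H = H^⊥. -/

import Mathlib

/-- The bimultiplicative form associated to a quadratic form `q` on a group:
`b(g,h) = q(g*h) * q(g)⁻¹ * q(h)⁻¹`. -/
def metricForm {G : Type*} [Group G] (q : G → ℂˣ) (g h : G) : ℂˣ :=
  q (g * h) * (q g)⁻¹ * (q h)⁻¹

lemma eq_univ_of_card_eq_four {G : Type*} [Fintype G] [DecidableEq G]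
    (hcard : Fintype.card G = 4) {a b c d : G} (hab : a ≠ b) (hac : a ≠ c) (had : a ≠ d)
    (hbc : b ≠ c) (hbd : b ≠ d) (hcd : c ≠ d) :
    (Finset.univ : Finset G) = {a, b, c, d} := by
  symm
  apply Finset.eq_univ_of_card
  rw [hcard]
  simp [Finset.card_insert_of_notMem, *]

lemma eq_or_of_pow_four_eq_one {x : ℂ} (hx : x ^ 4 = 1) :
    x = 1 ∨ x = -1 ∨ x = Complex.I ∨ x = -Complex.I := by
  have h : (x - 1) * ((x + 1) * ((x - Complex.I) * (x + Complex.I))) = 0 := by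
    linear_combination hx + (1 - x ^ 2) * Complex.I_sq
  rcases mul_eq_zero.1 h with h | h
  · exact Or.inl (sub_eq_zero.1 h)
  rcases mul_eq_zero.1 h with h | h
  · exact Or.inr (Or.inl (eq_neg_of_add_eq_zero_left h))
  rcases mul_eq_zero.1 h with h | h
  · exact Or.inr (Or.inr (Or.inl (sub_eq_zero.1 h)))
  · exact Or.inr (Or.inr (Or.inr (eq_neg_of_add_eq_zero_left h)))

/-- If three fourth roots of unity sum to `1`, then one of them is `1`. -/
lemma exists_eq_one_of_add_eq_one {x y z : ℂ} (hx : x ^ 4 = 1) (hy : y ^ 4 = 1)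
    (hz : z ^ 4 = 1) (h : x + y + z = 1) : x = 1 ∨ y = 1 ∨ z = 1 := by
  rcases eq_or_of_pow_four_eq_one hx with hx | hx
  · exact Or.inl hx
  rcases eq_or_of_pow_four_eq_one hy with hy | hy
  · exact Or.inr (Or.inl hy)
  rcases eq_or_of_pow_four_eq_one hz with hz | hz
  · exact Or.inr (Or.inr hz)
  have re_nonpos : ∀ w : ℂ, w = -1 ∨ w = Complex.I ∨ w = -Complex.I → w.re ≤ 0 := by
    rintro w (rfl | rfl | rfl) <;> simp
  have hre := congrArg Complex.re h
  simp only [Complex.add_re, Complex.one_re] at hre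
  linarith [re_nonpos x hx, re_nonpos y hy, re_nonpos z hz]

section MetricGroup

variable {G : Type*} [CommGroup G] {q : G → ℂˣ}

lemma metricForm_comm (g h : G) : metricForm q g h = metricForm q h g := by
  simp only [metricForm, mul_comm g h, mul_right_comm]

lemma metricForm_one_left
    (hq2 : ∀ g₁ g₂ h : G, metricForm q (g₁ * g₂) h = metricForm q g₁ h * metricForm q g₂ h)
    (h : G) : metricForm q 1 h = 1 := by
  simpa using hq2 1 1 h

lemma map_one_of_metricForm_mul
    (hq2 : ∀ g₁ g₂ h : G, metricForm q (g₁ * g₂) h = metricForm q g₁ h * metricForm q g₂ h) :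
    q 1 = 1 := by
  simpa [metricForm] using metricForm_one_left hq2 1

lemma map_sq_of_metricForm_mul (hq1 : ∀ g : G, q g⁻¹ = q g)
    (hq2 : ∀ g₁ g₂ h : G, metricForm q (g₁ * g₂) h = metricForm q g₁ h * metricForm q g₂ h)
    (g : G) : q (g ^ 2) = q g ^ 4 := by
  have h := hq2 g g⁻¹ g
  rw [mul_inv_cancel, metricForm_one_left hq2] at h
  simp only [metricForm, inv_mul_cancel, hq1, map_one_of_metricForm_mul hq2, ← pow_two] at h
  have h' : q (g ^ 2) * (q g ^ 4)⁻¹ = 1 := by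
    rw [h]
    group
  exact mul_inv_eq_one.1 h'

/-- In a nondegenerate metric group of order four, an isotropic involution generates a
Lagrangian subgroup. -/
lemma exists_lagrangian_of_isotropic_involution [Fintype G]
    (hq2 : ∀ g₁ g₂ h : G, metricForm q (g₁ * g₂) h = metricForm q g₁ h * metricForm q g₂ h)
    (hnd : ∀ g : G, (∀ h : G, metricForm q g h = 1) → g = 1)
    (hcard : Fintype.card G = 4) {a : G} (ha : a ≠ 1) (ha2 : a ^ 2 = 1) (hqa : q a = 1) :
    ∃ H : Subgroup G, Nat.card ↥H = 2 ∧ (∀ h ∈ H, q h = 1) ∧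
      (H : Set G) = {g : G | ∀ h ∈ H, metricForm q g h = 1} := by
  classical
  have hq_one := map_one_of_metricForm_mul hq2
  have mem_iff : ∀ g, g ∈ Subgroup.zpowers a ↔ g = 1 ∨ g = a := by
    intro g
    constructor
    · rintro ⟨n, rfl⟩
      rcases Int.even_or_odd' n with ⟨k, rfl | rfl⟩
      · left
        simp [zpow_mul, ha2]
      · right
        simp [zpow_add, zpow_mul, ha2]
    · rintro (rfl | rfl)
      · exact one_mem _
      · exact Subgroup.mem_zpowers _
  have haa : metricForm q a a = 1 := by
    simp [metricForm, ← pow_two, ha2, hqa, hq_one]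
  refine ⟨Subgroup.zpowers a, ?_, ?_, ?_⟩
  · rw [Nat.card_zpowers, orderOf_eq_prime ha2 ha]
  · intro h hh
    rcases (mem_iff h).1 hh with rfl | rfl
    · exact hq_one
    · exact hqa
  ext g
  simp only [SetLike.mem_coe, Set.mem_ofPred_eq, mem_iff, forall_eq_or_imp, forall_eq]
  constructor
  · rintro (rfl | rfl)
    · exact ⟨metricForm_one_left hq2 _, metricForm_one_left hq2 _⟩
    · exact ⟨by rw [metricForm_comm, metricForm_one_left hq2], haa⟩
  · rintro ⟨-, hga⟩
    by_contra! hg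
    have hag : a * g ≠ 1 := by
      intro h
      apply hg.2
      apply mul_left_cancel (a := a)
      rw [h, ← pow_two, ha2]
    have huniv := eq_univ_of_card_eq_four hcard ha.symm hg.1.symm hag.symm hg.2.symm
      (by simpa using hg.1) (by simpa using ha : g ≠ a * g)
    refine ha (hnd a fun h => ?_)
    have hh := Finset.mem_univ h
    rw [huniv] at hh
    simp only [Finset.mem_insert, Finset.mem_singleton] at hh
    rw [metricForm_comm]
    rcases hh with rfl | rfl | rfl | rfl
    · exact metricForm_one_left hq2 _
    · exact haa
    · exact hga
    · rw [hq2, haa, hga, one_mul]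

/-- A metric group of order four with Gauss sum `2` contains an isotropic involution. -/
lemma exists_isotropic_involution [Fintype G] (hq1 : ∀ g : G, q g⁻¹ = q g)
    (hq2 : ∀ g₁ g₂ h : G, metricForm q (g₁ * g₂) h = metricForm q g₁ h * metricForm q g₂ h)
    (hcard : Fintype.card G = 4) (hgauss : ∑ g : G, (q g : ℂ) = 2) :
    ∃ a : G, a ≠ 1 ∧ a ^ 2 = 1 ∧ q a = 1 := by
  classical
  have hq_one := map_one_of_metricForm_mul hq2
  have hsq := map_sq_of_metricForm_mul hq1 hq2
  by_cases hexp : ∀ g : G, g ^ 2 = 1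
  · have hpow : ∀ g : G, (q g : ℂ) ^ 4 = 1 := by
      intro g
      have h := hsq g
      rw [hexp, hq_one] at h
      rw [← Units.val_pow_eq_pow_val, ← h, Units.val_one]
    obtain ⟨a, ha⟩ : ∃ a : G, a ∉ ({1} : Finset G) := by
      by_contra! h
      have := Finset.card_le_card (fun g _ => h g : (Finset.univ : Finset G) ⊆ {1})
      simp [hcard] at this
    obtain ⟨b, hb⟩ : ∃ b : G, b ∉ ({1, a} : Finset G) := by
      by_contra! h
      have := (Finset.card_le_card (fun g _ => h g : (Finset.univ : Finset G) ⊆ {1, a})).trans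
        Finset.card_le_two
      simp [hcard] at this
    simp only [Finset.mem_insert, Finset.mem_singleton, not_or] at ha hb
    have hab : a * b ≠ 1 := by
      intro h
      apply hb.2
      apply mul_left_cancel (a := a)
      rw [h, ← pow_two, hexp]
    have ha_ne : a ≠ a * b := by simpa using hb.1
    have hb_ne : b ≠ a * b := by simpa using ha
    have ha' : (1 : G) ≠ a := Ne.symm ha
    have hb' : (1 : G) ≠ b := Ne.symm hb.1
    have hba : a ≠ b := Ne.symm hb.2
    rw [eq_univ_of_card_eq_four hcard ha' hb' hab.symm hba ha_ne hb_ne,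
      Finset.sum_insert (by simp [ha', hb', hab.symm]), Finset.sum_insert (by simp [hba, hb.1]),
      Finset.sum_insert (by simpa using ha), Finset.sum_singleton, hq_one, Units.val_one]
      at hgauss
    rcases exists_eq_one_of_add_eq_one (hpow a) (hpow b) (hpow (a * b))
      (by linear_combination hgauss) with h | h | h
    · exact ⟨a, ha, hexp a, Units.ext h⟩
    · exact ⟨b, hb.1, hexp b, Units.ext h⟩
    · exact ⟨a * b, hab, hexp _, Units.ext h⟩
  · push Not at hexp
    obtain ⟨g, hg⟩ := hexp
    have hg4 : g ^ 4 = 1 := hcard ▸ pow_card_eq_one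
    have hg1 : g ≠ 1 := by
      rintro rfl
      simp at hg
    have hinv : g ≠ g⁻¹ := by
      intro h
      exact hg (by rw [pow_two, ← eq_inv_iff_mul_eq_one, ← h])
    have hg_sq : g ≠ g ^ 2 := by simpa [pow_two] using hg1
    have hsq_inv : g ^ 2 ≠ g⁻¹ := by
      intro h
      have h3 : g ^ 3 = 1 := by rw [pow_succ, h, inv_mul_cancel]
      exact hg1 (by simpa [pow_succ g 3, h3] using hg4)
    have hg22 : (g ^ 2) ^ 2 = 1 := by rw [← pow_mul, hg4]
    refine ⟨g ^ 2, hg, hg22, ?_⟩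
    have hinv1 : (1 : G) ≠ g⁻¹ := by simpa using hg1
    rw [eq_univ_of_card_eq_four hcard hg1.symm hg.symm hinv1 hg_sq hinv hsq_inv,
      Finset.sum_insert (by simp [hg1.symm, hg.symm, hg1]),
      Finset.sum_insert (by simp [hg_sq, hinv]), Finset.sum_insert (by simpa using hsq_inv),
      Finset.sum_singleton, hq1, hsq g, hq_one, Units.val_one, Units.val_pow_eq_pow_val] at hgauss
    have hsum : 2 * (q g : ℂ) + (q g : ℂ) ^ 4 = 1 := by linear_combination hgauss
    have hform : metricForm q g g = q g ^ 2 := by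
      simp only [metricForm, ← pow_two, hsq g]
      group
    have h8 : q g ^ 8 = 1 := by
      have h := hq2 (g * g) (g * g) g
      rw [← pow_two, ← pow_two, hg22, metricForm_one_left hq2, pow_two, hq2, hform] at h
      rw [h]
      group
    have h8' : ((q g : ℂ) ^ 4) ^ 2 = 1 := by
      rw [← pow_mul, ← Units.val_pow_eq_pow_val, h8, Units.val_one]
    rw [hsq g]
    apply Units.ext
    rw [Units.val_pow_eq_pow_val, Units.val_one]
    rcases eq_or_eq_neg_of_sq_eq_sq _ 1 (h8'.trans (one_pow 2).symm) with h | h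
    · exact h
    · have h1 : (q g : ℂ) = 1 := by linear_combination (hsum - h) / 2
      rw [h1, one_pow]

end MetricGroup

/-- A nondegenerate metric group `(G,q)` with `|G| = 4` and Gauss
sum `∑ q(g) = 2` contains a Lagrangian subgroup of order `2`. -/
theorem order_four_central_charge_one_has_lagrangian
    {G : Type*} [CommGroup G] [Fintype G] (q : G → ℂˣ)
    (hq1 : ∀ g : G, q g⁻¹ = q g)
    (hq2 : ∀ g₁ g₂ h : G, metricForm q (g₁ * g₂) h = metricForm q g₁ h * metricForm q g₂ h)
    (hnd : ∀ g : G, (∀ h : G, metricForm q g h = 1) → g = 1)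
    (hcard : Fintype.card G = 4)
    (hgauss : ∑ g : G, (q g : ℂ) = 2) :
    ∃ H : Subgroup G, Nat.card ↥H = 2 ∧ (∀ h ∈ H, q h = 1) ∧
      (H : Set G) = {g : G | ∀ h ∈ H, metricForm q g h = 1} := by
  obtain ⟨a, ha, ha2, hqa⟩ := exists_isotropic_involution hq1 hq2 hcard hgauss
  exact exists_lagrangian_of_isotropic_involution hq2 hnd hcard ha ha2 hqa
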